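/- Let M be a finitely generated additive submonoid of ℤⁿ. Then the image of the set of additive monoid homomorphisms M → ℝ≥0, under postcomposition with the inclusion ℝ≥0 ↪ ℝ≥0∞, is dense in the set of additive monoid homomorphisms M → ℝ≥0∞ equipped with the topology of pointwise convergence. In particular, the extended cone Hom(M, ℝ≥0∞) is a compactification of the cone Hom(M, ℝ≥0). -/

import Mathlib

open NNReal ENNReal Filter Topology

theorem Algebra.GrothendieckAddGroup.lift_of {M G : Type*} [AddCommMonoid M] [AddCommGroup G]
    (f : M →+ G) (m : M) : lift f (of m) = f m :=
  DFunLike.congr_fun (lift.symm_apply_apply f) m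

/-- A real-valued additive map on a monoid extends along an embedding into an abelian group. -/
theorem AddMonoidHom.exists_real_extension {M A : Type*} [AddCommMonoid M] [AddCommGroup A]
    (i : M →+ A) (hi : Function.Injective i) (f : M →+ ℝ) :
    ∃ g : A →+ ℝ, ∀ m, g (i m) = f m := by
  have hinj : Function.Injective (Algebra.GrothendieckAddGroup.lift i) := by
    rw [injective_iff_map_eq_zero]
    intro x hx
    rw [Algebra.GrothendieckAddGroup.lift_apply, sub_eq_zero] at hx
    have h := (AddLocalization.addMonoidOf (⊤ : AddSubmonoid M)).sec_spec x
    rw [hi hx] at h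
    simpa using h
  obtain ⟨g, hg⟩ := (Module.Baer.of_divisible ℝ).extension_property_addMonoidHom
    (Algebra.GrothendieckAddGroup.lift i) hinj (Algebra.GrothendieckAddGroup.lift f)
  refine ⟨g, fun m => ?_⟩
  have h := DFunLike.congr_fun hg (Algebra.GrothendieckAddGroup.of m)
  rwa [AddMonoidHom.comp_apply, Algebra.GrothendieckAddGroup.lift_of,
    Algebra.GrothendieckAddGroup.lift_of] at h

/-- An element of infinite order is not killed by some real-valued additive map. -/
theorem exists_addMonoidHom_real_apply_eq_one {A : Type*} [AddCommGroup A] (a : A)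
    (ha : ∀ k : ℤ, k • a = 0 → k = 0) : ∃ f : A →+ ℝ, f a = 1 := by
  obtain ⟨f, hf⟩ := AddMonoidHom.exists_real_extension (zmultiplesHom A a)
    ((injective_iff_map_eq_zero _).2 fun k hk => ha k (by simpa using hk)) (Int.castAddHom ℝ)
  exact ⟨f, by simpa using hf 1⟩

/-- Gordan's alternative in an abelian group: a finite family is either made positive by some
real-valued additive map, or satisfies a nontrivial relation with natural coefficients. -/
theorem gordan_alternative {ι : Type*} (s : Finset ι) :
    ∀ {A : Type*} [AddCommGroup A] (v : ι → A),
      (∃ f : A →+ ℝ, ∀ i ∈ s, 0 < f (v i)) ∨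
        ∃ c : ι → ℕ, (∃ i ∈ s, c i ≠ 0) ∧ ∑ i ∈ s, c i • v i = 0 := by
  classical
  induction s using Finset.induction_on with
  | empty => intro A _ v; exact Or.inl ⟨0, by simp⟩
  | insert a s ha ih =>
    intro A _ v
    have upd (c : ι → ℕ) (k : ℕ) : ∑ i ∈ insert a s, Function.update c a k i • v i =
        k • v a + ∑ i ∈ s, c i • v i := by
      rw [Finset.sum_insert ha, Function.update_self]
      congr 1
      refine Finset.sum_congr rfl fun i hi => ?_
      rw [Function.update_of_ne (ne_of_mem_of_not_mem hi ha)]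
    have relation (c : ι → ℕ) (k : ℕ) (hc : ∃ i ∈ s, c i ≠ 0)
        (h : k • v a + ∑ i ∈ s, c i • v i = 0) :
        ∃ c : ι → ℕ, (∃ i ∈ insert a s, c i ≠ 0) ∧ ∑ i ∈ insert a s, c i • v i = 0 := by
      obtain ⟨i, hi, hci⟩ := hc
      refine ⟨Function.update c a k, ⟨i, Finset.mem_insert_of_mem hi, ?_⟩, by rw [upd, h]⟩
      rwa [Function.update_of_ne (ne_of_mem_of_not_mem hi ha)]
    by_cases htor : ∀ k : ℤ, k • v a = 0 → k = 0
    · rcases ih (fun i => (QuotientAddGroup.mk (v i) : A ⧸ AddSubgroup.zmultiples (v a))) with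
        ⟨f, hf⟩ | ⟨c, hc, hsum⟩
      · obtain ⟨g, hg⟩ := exists_addMonoidHom_real_apply_eq_one (v a) htor
        have hev : ∀ᶠ k : ℕ in atTop, ∀ i ∈ s, 0 < g (v i) + k * f (v i) := by
          refine (Filter.eventually_all_finset s).2 fun i hi => ?_
          exact (tendsto_atTop_add_const_left _ _
            (tendsto_natCast_atTop_atTop.atTop_mul_const (hf i hi))).eventually_gt_atTop 0
        obtain ⟨k, hk⟩ := hev.exists
        refine Or.inl ⟨g + k • f.comp (QuotientAddGroup.mk' _), fun i hi => ?_⟩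
        rcases Finset.mem_insert.1 hi with rfl | hi
        · have h0 : (QuotientAddGroup.mk (v i) : A ⧸ AddSubgroup.zmultiples (v i)) = 0 :=
            (QuotientAddGroup.eq_zero_iff _).2 (AddSubgroup.mem_zmultiples _)
          simp [hg, h0]
        · simpa using hk i hi
      · have hmem : ∑ i ∈ s, c i • v i ∈ AddSubgroup.zmultiples (v a) := by
          rw [← QuotientAddGroup.eq_zero_iff, ← QuotientAddGroup.mk'_apply, map_sum]
          simpa using hsum
        obtain ⟨z, hz⟩ := AddSubgroup.mem_zmultiples_iff.1 hmem
        rcases le_or_gt z 0 with hz0 | hz0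
        · obtain ⟨k, hk⟩ := Int.eq_ofNat_of_zero_le (neg_nonneg.2 hz0)
          refine Or.inr (relation c k hc ?_)
          rw [← hz, ← natCast_zsmul, ← hk, neg_smul, neg_add_cancel]
        · rcases ih v with ⟨f, hf⟩ | ⟨d, hd, hd0⟩
          · refine Or.inl ⟨f, fun i hi => ?_⟩
            rcases Finset.mem_insert.1 hi with rfl | hi
            · have hpos : 0 < ∑ j ∈ s, (c j : ℝ) * f (v j) := by
                obtain ⟨j, hj, hcj⟩ := hc
                refine Finset.sum_pos' (fun j hj => mul_nonneg (Nat.cast_nonneg _) (hf j hj).le)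
                  ⟨j, hj, mul_pos (by positivity) (hf j hj)⟩
              have hfz : (z : ℝ) * f (v i) = ∑ j ∈ s, (c j : ℝ) * f (v j) := by
                simpa using congrArg f hz
              exact pos_of_mul_pos_right (hfz ▸ hpos) (by positivity)
            · exact hf i hi
          · exact Or.inr (relation d 0 hd (by simpa using hd0))
    · push Not at htor
      obtain ⟨k, hk, hk0⟩ := htor
      refine Or.inr ⟨Function.update 0 a k.natAbs, ⟨a, Finset.mem_insert_self _ _, by simpa⟩, ?_⟩
      rw [upd]
      rcases Int.natAbs_eq k with h | h <;> rw [h] at hk <;> simpa using hk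

/-- A face `F` of a finitely generated submonoid of an abelian group is cut out by a real-valued
additive map which is positive on the generators outside `F`. -/
theorem exists_addMonoidHom_real_pos_of_face {A : Type*} [AddCommGroup A] (S : Finset A)
    (F : AddSubmonoid A) (hF : ∀ a ∈ AddSubmonoid.closure (S : Set A),
      ∀ b ∈ AddSubmonoid.closure (S : Set A), a + b ∈ F → a ∈ F)
    (hFS : F ≤ AddSubmonoid.closure (S : Set A)) :
    ∃ h : A →+ ℝ, (∀ a ∈ F, h a = 0) ∧ ∀ a ∈ S, a ∉ F → 0 < h a := by
  classical
  let H := AddSubgroup.closure (F : Set A)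
  rcases gordan_alternative (S.filter (· ∉ F)) (fun a => (QuotientAddGroup.mk a : A ⧸ H)) with
    ⟨f, hf⟩ | ⟨c, ⟨a, ha, hca⟩, hsum⟩
  · refine ⟨f.comp (QuotientAddGroup.mk' H), fun a ha => ?_, fun a ha haF => ?_⟩
    · have h0 : (QuotientAddGroup.mk a : A ⧸ H) = 0 :=
        (QuotientAddGroup.eq_zero_iff _).2 (AddSubgroup.subset_closure ha)
      simp [h0]
    · exact hf a (Finset.mem_filter.2 ⟨ha, haF⟩)
  · exfalso
    have hdiff : ∀ x ∈ H, ∃ p ∈ F, ∃ q ∈ F, x + p = q := by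
      intro x hx
      induction hx using AddSubgroup.closure_induction with
      | mem x hx => exact ⟨0, F.zero_mem, x, hx, by simp⟩
      | zero => exact ⟨0, F.zero_mem, 0, F.zero_mem, by simp⟩
      | add x y _ _ hx hy =>
        obtain ⟨p, hp, q, hq, h⟩ := hx
        obtain ⟨p', hp', q', hq', h'⟩ := hy
        exact ⟨p + p', F.add_mem hp hp', q + q', F.add_mem hq hq', by rw [← h, ← h']; abel⟩
      | neg x _ hx =>
        obtain ⟨p, hp, q, hq, h⟩ := hx
        exact ⟨q, hq, p, hp, by rw [← h]; abel⟩
    have hmem : ∑ i ∈ S.filter (· ∉ F), c i • i ∈ H := by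
      rw [← QuotientAddGroup.eq_zero_iff, ← QuotientAddGroup.mk'_apply, map_sum]
      simpa using hsum
    obtain ⟨p, hp, q, hq, h⟩ := hdiff _ hmem
    obtain ⟨haS, haF⟩ := Finset.mem_filter.1 ha
    have hgen : ∀ b ∈ S, b ∈ AddSubmonoid.closure (S : Set A) := fun b hb =>
      AddSubmonoid.subset_closure hb
    obtain ⟨k, hk⟩ := Nat.exists_eq_succ_of_ne_zero hca
    rw [← Finset.add_sum_erase _ _ ha, hk, succ_nsmul', add_assoc, add_assoc] at h
    refine haF (hF a (hgen a haS) _ (add_mem (nsmul_mem (hgen a haS) k)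
      (add_mem (sum_mem fun b hb => nsmul_mem (hgen b ?_) _) (hFS hp))) (h ▸ hq))
    exact (Finset.mem_filter.1 (Finset.mem_of_mem_erase hb)).1

/-- An additive map `g` to `ℝ≥0∞` from a finitely generated submonoid of an abelian group admits
real-valued additive maps `L` and `h`, with `L` equal to `g` and `h` zero where `g` is finite, `h`
positive where `g` is infinite, and `L + h` nonnegative. -/
theorem exists_addMonoidHom_real_approx {A : Type*} [AddCommGroup A] {M : AddSubmonoid A}
    (hM : M.FG) (g : M →+ ℝ≥0∞) :
    ∃ L h : A →+ ℝ, (∀ m : M, g m ≠ ∞ → L m = (g m).toReal ∧ h m = 0) ∧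
      (∀ m : M, g m = ∞ → 0 < h m) ∧ ∀ m : M, 0 ≤ L m + h m := by
  obtain ⟨S, rfl⟩ := hM
  let F : AddSubmonoid (AddSubmonoid.closure (S : Set A)) :=
    { carrier := {m | g m ≠ ∞}
      zero_mem' := by simp
      add_mem' := fun {a b} ha hb => by simpa using ⟨ha, hb⟩ }
  have hF (m) : m ∈ F ↔ g m ≠ ∞ := Iff.rfl
  obtain ⟨h, hF0, hpos⟩ := exists_addMonoidHom_real_pos_of_face S
    (F.map (AddSubmonoid.closure (S : Set A)).subtype)
    (by
      rintro a ha b hb ⟨m, hm, hab⟩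
      obtain rfl : m = ⟨a, ha⟩ + ⟨b, hb⟩ := Subtype.ext hab
      refine ⟨⟨a, ha⟩, ?_, rfl⟩
      have hm' := (hF _).1 hm
      rw [map_add, ENNReal.add_ne_top] at hm'
      exact hm'.1)
    (by rintro _ ⟨m, -, rfl⟩; exact m.2)
  have hzero (m : AddSubmonoid.closure (S : Set A)) (hm : g m ≠ ∞) : h m = 0 :=
    hF0 m ⟨m, hm, rfl⟩
  have hgen (a : A) (ha : a ∈ S) (hga : g ⟨a, AddSubmonoid.subset_closure ha⟩ = ∞) : 0 < h a := by
    refine hpos a ha ?_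
    rintro ⟨m, hm, rfl⟩
    exact hm hga
  have hnonneg (m : AddSubmonoid.closure (S : Set A)) : 0 ≤ h m ∧ (g m = ∞ → 0 < h m) := by
    obtain ⟨m, hm⟩ := m
    induction hm using AddSubmonoid.closure_induction with
    | mem a ha =>
      refine ⟨?_, hgen a ha⟩
      by_cases hga : g ⟨a, AddSubmonoid.subset_closure ha⟩ = ∞
      · exact (hgen a ha hga).le
      · exact (hzero _ hga).ge
    | zero =>
      refine ⟨by simp, fun h0 => ?_⟩
      exact absurd ((map_zero g).symm.trans h0) ENNReal.zero_ne_top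
    | add a b ha hb iha ihb =>
      refine ⟨by simpa using add_nonneg iha.1 ihb.1, fun hab => ?_⟩
      have hab' : g ⟨a, ha⟩ + g ⟨b, hb⟩ = ∞ := (map_add g _ _).symm.trans hab
      simp only [map_add]
      rcases ENNReal.add_eq_top.1 hab' with hc | hc
      · exact add_pos_of_pos_of_nonneg (iha.2 hc) ihb.1
      · exact add_pos_of_nonneg_of_pos iha.1 (ihb.2 hc)
  let f : F →+ ℝ :=
    { toFun := fun m => (g m).toReal
      map_zero' := by simp
      map_add' := fun a b => by simpa using ENNReal.toReal_add a.2 b.2 }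
  obtain ⟨L, hL⟩ := AddMonoidHom.exists_real_extension
    ((AddSubmonoid.closure (S : Set A)).subtype.comp F.subtype)
    (Subtype.val_injective.comp Subtype.val_injective) f
  have hLF (m : AddSubmonoid.closure (S : Set A)) (hm : g m ≠ ∞) : L m = (g m).toReal :=
    hL ⟨m, hm⟩
  have hev : ∀ᶠ k : ℕ in atTop, 0 < k ∧ ∀ a ∈ S, 0 ≤ L a + k * h a := by
    refine (eventually_gt_atTop 0).and ((Filter.eventually_all_finset S).2 fun a ha => ?_)
    by_cases hga : g ⟨a, AddSubmonoid.subset_closure ha⟩ = ∞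
    · exact (tendsto_atTop_add_const_left _ _
        (tendsto_natCast_atTop_atTop.atTop_mul_const (hgen a ha hga))).eventually_ge_atTop 0
    · refine Eventually.of_forall fun k => ?_
      rw [show L a = _ from hLF _ hga, show h a = 0 from hzero _ hga]
      simp
  obtain ⟨k, hk0, hk⟩ := hev.exists
  refine ⟨L, k • h, fun m hm => ⟨hLF m hm, by simp [hzero m hm]⟩, fun m hm => ?_, fun m => ?_⟩
  · simpa using mul_pos (Nat.cast_pos.2 hk0) ((hnonneg m).2 hm)
  · obtain ⟨m, hm⟩ := m
    induction hm using AddSubmonoid.closure_induction with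
    | mem a ha => simpa using hk a ha
    | zero => simp
    | add a b _ _ ha hb =>
      simp only [map_add] at ha hb ⊢
      linarith

/-- For a finitely generated additive submonoid `M` of `ℤⁿ`, the image of the set of
additive monoid homomorphisms `M → ℝ≥0`, under postcomposition with the inclusion
`ℝ≥0 ↪ ℝ≥0∞`, is dense in the set of additive monoid homomorphisms `M → ℝ≥0∞`
(with the topology of pointwise convergence). In particular, the extended cone
`Hom(M, ℝ≥0∞)` is a compactification of the cone `Hom(M, ℝ≥0)`. -/
theorem cone_dense_in_extendedCone (n : ℕ) (M : AddSubmonoid (Fin n → ℤ)) (hM : M.FG) :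
    Dense {g : {g : M → ℝ≥0∞ // g 0 = 0 ∧ ∀ a b : M, g (a + b) = g a + g b} |
        ∃ φ : M → ℝ≥0, (φ 0 = 0 ∧ ∀ a b : M, φ (a + b) = φ a + φ b) ∧
          ∀ m : M, g.1 m = (φ m : ℝ≥0∞)} ∧
      CompactSpace {g : M → ℝ≥0∞ // g 0 = 0 ∧ ∀ a b : M, g (a + b) = g a + g b} := by
  refine ⟨fun g => ?_, ?_⟩
  · obtain ⟨L, h, hfin, htop, hnonneg⟩ := exists_addMonoidHom_real_approx hM
      { toFun := g.1, map_zero' := g.2.1, map_add' := g.2.2 }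
    simp only [AddMonoidHom.coe_mk, ZeroHom.coe_mk] at hfin htop
    have hh (m : M) : 0 ≤ h m := by
      by_cases hm : g.1 m = ∞
      · exact (htop m hm).le
      · exact (hfin m hm).2.ge
    have hk (k : ℕ) (m : M) : 0 ≤ L m + h m + k * h m :=
      add_nonneg (hnonneg m) (mul_nonneg k.cast_nonneg (hh m))
    have hadd (k : ℕ) (a b : M) :
        Real.toNNReal (L (a + b : M) + h (a + b : M) + k * h (a + b : M)) =
        Real.toNNReal (L a + h a + k * h a) + Real.toNNReal (L b + h b + k * h b) := by
      rw [← Real.toNNReal_add (hk k a) (hk k b)]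
      congr 1
      simp only [AddSubmonoid.coe_add, map_add]
      ring
    let G (k : ℕ) : {g : M → ℝ≥0∞ // g 0 = 0 ∧ ∀ a b : M, g (a + b) = g a + g b} :=
      ⟨fun m => ENNReal.ofReal (L m + h m + k * h m), by simp, fun a b => by
        simp only [ENNReal.ofReal, hadd, ENNReal.coe_add]⟩
    refine mem_closure_of_tendsto (f := G) (b := atTop) ?_ (Eventually.of_forall fun k =>
      ⟨fun m => Real.toNNReal (L m + h m + k * h m), ⟨by simp, hadd k⟩, fun m => rfl⟩)
    refine tendsto_subtype_rng.2 (tendsto_pi_nhds.2 fun m => ?_)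
    by_cases hm : g.1 m = ∞
    · rw [hm]
      exact ENNReal.tendsto_ofReal_atTop.comp (tendsto_atTop_add_const_left _ _
        (tendsto_natCast_atTop_atTop.atTop_mul_const (htop m hm)))
    · refine tendsto_const_nhds.congr fun k => ?_
      simp [G, hfin m hm, ENNReal.ofReal_toReal hm]
  · have hclosed : IsClosed {g : M → ℝ≥0∞ | g 0 = 0 ∧ ∀ a b : M, g (a + b) = g a + g b} := by
      simp only [Set.ofPred_and, Set.ofPred_forall]
      exact (isClosed_eq (continuous_apply _) continuous_const).inter
        (isClosed_iInter fun a => isClosed_iInter fun b => isClosed_eq (by fun_prop) (by fun_prop))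
    exact isCompact_iff_compactSpace.1 hclosed.isCompact
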